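/- arXiv:1902.00932 — 6 statements merged into one kernel-verified Lean document; each statement's English description precedes it below -/
import Mathlib

section
/- Let A be a mild abelian group, let B be a mild abelian group which is divisible and torsion (equivalently, B is isomorphic to (ℚ/ℤ)^s for some nonnegative integer s), and let f: A → B be an injective group homomorphism. Then the cokernel of f is a mild abelian group. -/
noncomputable section

universe u v

/-- The abelian group `ℚ/ℤ`. -/
abbrev QmodZ : Type := AddCircle (1 : ℚ)

/-- An abelian group is *uniquely divisible* if every element has a unique `n`-th divisor
for every positive integer `n`. -/
def IsUniquelyDivisible (V : Type*) [AddCommGroup V] : Prop :=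
  ∀ (v : V) (n : ℕ), 0 < n → ∃! w : V, n • w = v

/-- The subgroup of divisible elements of an abelian group. -/
def divisibleSubgroup (G : Type*) [AddCommGroup G] : AddSubgroup G where
  carrier := {g | ∀ n : ℕ, 0 < n → ∃ h : G, n • h = g}
  zero_mem' := fun n _ => ⟨0, smul_zero n⟩
  add_mem' := by
    intro a b ha hb n hn
    obtain ⟨x, hx⟩ := ha n hn
    obtain ⟨y, hy⟩ := hb n hn
    exact ⟨x + y, by rw [smul_add, hx, hy]⟩
  neg_mem' := by
    intro a ha n hn
    obtain ⟨x, hx⟩ := ha n hn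
    exact ⟨-x, by rw [smul_neg, hx]⟩

@[simp] lemma mem_divisibleSubgroup {G : Type*} [AddCommGroup G] (g : G) :
    g ∈ divisibleSubgroup G ↔ ∀ n : ℕ, 0 < n → ∃ h : G, n • h = g := Iff.rfl

/-- The torsion subgroup of an abelian group. -/
def torsionSubgroup (G : Type*) [AddCommGroup G] : AddSubgroup G where
  carrier := {g | ∃ n : ℕ, 0 < n ∧ n • g = 0}
  zero_mem' := ⟨1, Nat.one_pos, smul_zero 1⟩
  add_mem' := by
    rintro a b ⟨m, hm, ha⟩ ⟨n, hn, hb⟩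
    refine ⟨m * n, Nat.mul_pos hm hn, ?_⟩
    have ha' : (m * n) • a = 0 := by rw [mul_comm, mul_smul, ha, smul_zero]
    have hb' : (m * n) • b = 0 := by rw [mul_smul, hb, smul_zero]
    rw [smul_add, ha', hb', add_zero]
  neg_mem' := by
    rintro a ⟨n, hn, ha⟩
    exact ⟨n, hn, by rw [smul_neg, ha, neg_zero]⟩

@[simp] lemma mem_torsionSubgroup {G : Type*} [AddCommGroup G] (g : G) :
    g ∈ torsionSubgroup G ↔ ∃ n : ℕ, 0 < n ∧ n • g = 0 := Iff.rfl

/-- The subgroup of divisible torsion elements: `G_td = G_tor ⊓ G_div`. -/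
def tdSubgroup (G : Type*) [AddCommGroup G] : AddSubgroup G :=
  torsionSubgroup G ⊓ divisibleSubgroup G

/-- `G` is *mild with invariants `s` and `r`* if it is a direct sum of a uniquely divisible
group, `(ℚ/ℤ)^s`, a free abelian group of rank `r`, and a finite abelian group. -/
def IsMildWith (G : Type u) [AddCommGroup G] (s r : ℕ) : Prop :=
  ∃ (V T : Type u) (_ : AddCommGroup V) (_ : AddCommGroup T),
    IsUniquelyDivisible V ∧ Finite T ∧
      Nonempty (G ≃+ V × (Fin s → QmodZ) × (Fin r → ℤ) × T)

/-- A *mild* abelian group. -/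
def IsMild (G : Type u) [AddCommGroup G] : Prop :=
  ∃ s r : ℕ, IsMildWith G s r

lemma AddEquiv.natCard_ker_nsmul {G H : Type*} [AddCommGroup G] [AddCommGroup H] (e : G ≃+ H)
    (n : ℕ) :
    Nat.card (nsmulAddMonoidHom (α := G) n).ker = Nat.card (nsmulAddMonoidHom (α := H) n).ker :=
  Nat.card_congr <| e.toEquiv.subtypeEquiv fun x => by
    simp [AddMonoidHom.mem_ker, ← map_nsmul]

lemma AddEquiv.index_range_nsmul_eq {G H : Type*} [AddCommGroup G] [AddCommGroup H] (e : G ≃+ H)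
    (n : ℕ) :
    (nsmulAddMonoidHom (α := G) n).range.index = (nsmulAddMonoidHom (α := H) n).range.index := by
  rw [← AddSubgroup.index_map_equiv _ e, AddEquiv.map_range_nsmulAddMonoidHom]

lemma natCard_ker_nsmul_prod (G H : Type*) [AddCommGroup G] [AddCommGroup H] (n : ℕ) :
    Nat.card (nsmulAddMonoidHom (α := G × H) n).ker =
      Nat.card (nsmulAddMonoidHom (α := G) n).ker *
        Nat.card (nsmulAddMonoidHom (α := H) n).ker := by
  have h : (nsmulAddMonoidHom (α := G × H) n).ker =
      (nsmulAddMonoidHom (α := G) n).ker.prod (nsmulAddMonoidHom (α := H) n).ker := by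
    ext x
    simp [AddMonoidHom.mem_ker, AddSubgroup.mem_prod, Prod.ext_iff]
  rw [h, Nat.card_congr (AddSubgroup.prodEquiv _ _).toEquiv, Nat.card_prod]

lemma index_range_nsmul_prod (G H : Type*) [AddCommGroup G] [AddCommGroup H] (n : ℕ) :
    (nsmulAddMonoidHom (α := G × H) n).range.index =
      (nsmulAddMonoidHom (α := G) n).range.index * (nsmulAddMonoidHom (α := H) n).range.index := by
  rw [← AddSubgroup.index_prod, ← AddMonoidHom.range_prodMap]
  rfl

lemma natCard_ker_nsmul_eq_index_range (T : Type*) [AddCommGroup T] [Finite T] (n : ℕ) :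
    Nat.card (nsmulAddMonoidHom (α := T) n).ker = (nsmulAddMonoidHom (α := T) n).range.index := by
  have h₁ := (nsmulAddMonoidHom (α := T) n).ker.card_mul_index
  have h₂ := (nsmulAddMonoidHom (α := T) n).range.index_mul_card
  rw [AddSubgroup.index_ker, ← h₂] at h₁
  exact Nat.eq_of_mul_eq_mul_right Nat.card_pos h₁

/-- If multiplication by `n` is surjective on `B`, the `n`-torsion of `B ⧸ A` is controlled by
that of `A` and `B` and by `A / nA`. -/
lemma natCard_ker_nsmul_quotient {B : Type*} [AddCommGroup B] (A : AddSubgroup B) (n : ℕ)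
    (hn : Function.Surjective (nsmulAddMonoidHom (α := B) n)) :
    Nat.card (nsmulAddMonoidHom (α := B ⧸ A) n).ker * Nat.card (nsmulAddMonoidHom (α := A) n).ker =
      (nsmulAddMonoidHom (α := A) n).range.index * Nat.card (nsmulAddMonoidHom (α := B) n).ker := by
  set N := nsmulAddMonoidHom (α := B) n with hN
  have hquot : (nsmulAddMonoidHom (α := B ⧸ A) n).ker =
      (A.comap N).map (QuotientAddGroup.mk' A) := by
    ext x
    obtain ⟨b, rfl⟩ := QuotientAddGroup.mk'_surjective A x
    have hx : n • (b : B ⧸ A) = 0 ↔ n • b ∈ A := by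
      rw [← QuotientAddGroup.mk_nsmul, QuotientAddGroup.eq_zero_iff]
    refine hx.trans ⟨fun h => ⟨b, h, rfl⟩, ?_⟩
    rintro ⟨c, hc, hcb⟩
    rw [← hx, ← QuotientAddGroup.mk'_apply, ← hcb, QuotientAddGroup.mk'_apply,
      ← QuotientAddGroup.mk_nsmul, QuotientAddGroup.eq_zero_iff]
    exact hc
  have hker : A ⊔ N.ker = (A.map N).comap N := (AddSubgroup.comap_map_eq N A).symm
  have hle : A ⊔ N.ker ≤ A.comap N := by
    rw [hker]
    refine AddSubgroup.comap_mono ?_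
    rintro _ ⟨a, ha, rfl⟩
    exact A.nsmul_mem ha n
  have htower := AddSubgroup.relIndex_mul_relIndex A _ _ le_sup_left hle
  rw [AddSubgroup.relIndex_sup_left, hker, AddSubgroup.relIndex_comap,
    AddSubgroup.map_comap_eq_self_of_surjective hn] at htower
  have hrange : (A.map N).relIndex A = (nsmulAddMonoidHom (α := A) n).range.index := by
    rw [AddSubgroup.relIndex, AddSubgroup.addSubgroupOf_map_nsmulAddMonoidHom_eq_range]
  have hA : Nat.card (nsmulAddMonoidHom (α := A) n).ker = Nat.card (A ⊓ N.ker : AddSubgroup B) :=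
    Nat.card_congr <| (Equiv.subtypeEquivRight fun a => by
      simp [hN, AddMonoidHom.mem_ker, Subtype.ext_iff]).trans
      (Equiv.subtypeSubtypeEquivSubtypeInter (· ∈ A) (· ∈ N.ker))
  have hcard := AddSubgroup.relIndex_mul_relIndex ⊥ (A ⊓ N.ker) N.ker bot_le inf_le_right
  rw [AddSubgroup.relIndex_bot_left, AddSubgroup.relIndex_bot_left,
    AddSubgroup.inf_relIndex_right] at hcard
  rw [hquot, ← AddSubgroup.relIndex_ker, QuotientAddGroup.ker_mk', ← htower, hrange, ← hcard, hA]
  ring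

lemma natCard_ker_nsmul_qmodZ {n : ℕ} (hn : 0 < n) :
    Nat.card (nsmulAddMonoidHom (α := QmodZ) n).ker = n := by
  have hn' : (n : ℚ) ≠ 0 := by positivity
  let g : Fin n → (nsmulAddMonoidHom (α := QmodZ) n).ker := fun m =>
    ⟨(((m : ℕ) / n * 1 : ℚ) : QmodZ), (AddCircle.nsmul_eq_zero_iff hn).2 ⟨m, m.2, rfl⟩⟩
  have hg : Function.Bijective g := by
    constructor
    · intro i j hij
      have h := Subtype.ext_iff.1 hij
      have hmem : ∀ k : Fin n, ((k : ℕ) / n * 1 : ℚ) ∈ Set.Ico (0 : ℚ) (0 + 1) := fun k => by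
        have : ((k : ℕ) : ℚ) < n := by exact_mod_cast k.2
        refine ⟨by positivity, ?_⟩
        rw [zero_add, mul_one, div_lt_one (by positivity)]
        exact this
      have h' := (AddCircle.coe_eq_coe_iff_of_mem_Ico (hmem i) (hmem j)).1 h
      field_simp at h'
      exact Fin.ext (by exact_mod_cast h')
    · rintro ⟨x, hx⟩
      obtain ⟨m, hm, h⟩ := (AddCircle.nsmul_eq_zero_iff hn).1 hx
      exact ⟨⟨m, hm⟩, Subtype.ext h⟩
  rw [← Nat.card_eq_of_bijective g hg, Nat.card_fin]

lemma natCard_ker_nsmul_pi_qmodZ (s : ℕ) {n : ℕ} (hn : 0 < n) :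
    Nat.card (nsmulAddMonoidHom (α := Fin s → QmodZ) n).ker = n ^ s := by
  have e : (nsmulAddMonoidHom (α := Fin s → QmodZ) n).ker ≃
      (Fin s → (nsmulAddMonoidHom (α := QmodZ) n).ker) :=
    (Equiv.subtypeEquivRight fun x => by simp [AddMonoidHom.mem_ker, funext_iff]).trans
      (Equiv.subtypePiEquivPi (p := fun _ x => x ∈ (nsmulAddMonoidHom (α := QmodZ) n).ker))
  rw [Nat.card_congr e, Nat.card_fun, natCard_ker_nsmul_qmodZ hn, Nat.card_fin]

lemma nsmul_pi_qmodZ_surjective (s : ℕ) {n : ℕ} (hn : 0 < n) :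
    Function.Surjective (nsmulAddMonoidHom (α := Fin s → QmodZ) n) := fun x => by
  refine ⟨fun i => DivisibleBy.div (x i) (n : ℤ), funext fun i => ?_⟩
  have := DivisibleBy.div_cancel (x i) (n := (n : ℤ)) (by omega)
  simpa using this

lemma exists_nsmul_eq_zero_pi_qmodZ (s : ℕ) (x : Fin s → QmodZ) : ∃ n : ℕ, 0 < n ∧ n • x = 0 := by
  have h : ∀ y : QmodZ, ∃ n : ℕ, 0 < n ∧ n • y = 0 := fun y => by
    obtain ⟨q, rfl⟩ := QuotientAddGroup.mk_surjective y
    refine ⟨q.den, q.pos, ?_⟩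
    have := AddCircle.addOrderOf_coe_rat (p := (1 : ℚ)) (q := q)
    rw [← this]
    simp
  choose n hn h0 using fun i => h (x i)
  refine ⟨∏ i, n i, Finset.prod_pos fun i _ => hn i, funext fun i => ?_⟩
  obtain ⟨k, hk⟩ := Finset.dvd_prod_of_mem n (Finset.mem_univ i)
  rw [Pi.smul_apply, hk, mul_comm, mul_smul, h0, smul_zero, Pi.zero_apply]

lemma iSupIndep_ker_nsmul_prime (G : Type*) [AddCommGroup G] :
    iSupIndep fun p : Nat.Primes => (nsmulAddMonoidHom (α := G) (p : ℕ)).ker := by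
  classical
  rw [← iSupIndep_map_orderIso_iff (AddSubgroup.toIntSubmodule : AddSubgroup G ≃o _),
    iSupIndep_iff_finsetSum_eq_zero_imp_eq_zero]
  intro s v hv h0 q hq
  have hv' : ∀ p ∈ s, (p : ℕ) • v p = 0 := hv
  have hN : (∏ p ∈ s.erase q, (p : ℕ)) • v q = 0 := by
    have h := congrArg ((∏ p ∈ s.erase q, (p : ℕ)) • ·) h0
    simp only [smul_zero, ← Finset.add_sum_erase s v hq, smul_add] at h
    rw [Finset.smul_sum, Finset.sum_eq_zero, add_zero] at h
    · exact h
    · intro p hp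
      obtain ⟨k, hk⟩ := Finset.dvd_prod_of_mem (fun p : Nat.Primes => (p : ℕ)) hp
      rw [hk, mul_comm, mul_smul, hv' p (Finset.mem_of_mem_erase hp), smul_zero]
  have hcop : Nat.Coprime (∏ p ∈ s.erase q, (p : ℕ)) q :=
    Nat.Coprime.prod_left fun p hp => (Nat.coprime_primes p.2 q.2).2 fun h =>
      Finset.ne_of_mem_erase hp (Subtype.ext h)
  rw [← addOrderOf_dvd_iff_nsmul_eq_zero] at hN
  have hq' := addOrderOf_dvd_iff_nsmul_eq_zero.2 (hv' q hq)
  exact AddMonoid.addOrderOf_eq_one_iff.1 (Nat.eq_one_of_dvd_coprimes hcop hN hq')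

/-- Elementary abelian `p`-groups of the same finite cardinality are isomorphic. -/
lemma nonempty_addEquiv_of_prime_nsmul_eq_zero {G H : Type*} [AddCommGroup G] [AddCommGroup H]
    {p : ℕ} (hp : p.Prime) (hG : ∀ x : G, p • x = 0) (hH : ∀ x : H, p • x = 0) [Finite G]
    (h : Nat.card G = Nat.card H) : Nonempty (G ≃+ H) := by
  have : Fact p.Prime := ⟨hp⟩
  have : Finite H := Nat.finite_of_card_ne_zero (h ▸ Nat.card_pos.ne')
  have : Module (ZMod p) G := AddCommGroup.zmodModule hG
  have : Module (ZMod p) H := AddCommGroup.zmodModule hH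
  rw [← FiniteField.pow_finrank_eq_natCard p G, ← FiniteField.pow_finrank_eq_natCard p H] at h
  have hfr : Module.finrank (ZMod p) G = Module.finrank (ZMod p) H :=
    Nat.pow_right_injective hp.two_le h
  obtain ⟨e⟩ := FiniteDimensional.nonempty_linearEquiv_of_finrank_eq hfr
  exact ⟨e.toAddEquiv⟩

/-- A divisible torsion group is determined by the cardinalities of its `n`-torsion subgroups,
provided these are finite. -/
theorem nonempty_addEquiv_of_natCard_ker_nsmul_eq {G H : Type*} [AddCommGroup G] [AddCommGroup H]
    (hG : ∀ x : G, ∃ n : ℕ, 0 < n ∧ n • x = 0) (hH : ∀ x : H, ∃ n : ℕ, 0 < n ∧ n • x = 0)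
    (hdiv : ∀ n : ℕ, 0 < n → Function.Surjective (nsmulAddMonoidHom (α := H) n))
    (hfin : ∀ n : ℕ, 0 < n → Finite (nsmulAddMonoidHom (α := G) n).ker)
    (hcard : ∀ n : ℕ, 0 < n → Nat.card (nsmulAddMonoidHom (α := G) n).ker =
      Nat.card (nsmulAddMonoidHom (α := H) n).ker) :
    Nonempty (G ≃+ H) := by
  classical
  let _ : DivisibleBy H ℤ := AddCommGroup.divisibleByIntOfSMulTopEqTop H fun {n} hn => by
    refine AddSubgroup.map_top_of_surjective _ fun y => ?_
    obtain ⟨x, hx⟩ := hdiv n.natAbs (Int.natAbs_pos.2 hn) y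
    refine ⟨n.sign • x, ?_⟩
    change n • n.sign • x = y
    rw [← mul_smul, Int.mul_sign_self, natCast_zsmul]
    exact hx
  have e : ∀ p : Nat.Primes, (nsmulAddMonoidHom (α := G) (p : ℕ)).ker ≃+
      (nsmulAddMonoidHom (α := H) (p : ℕ)).ker := fun p =>
    haveI := hfin p p.2.pos
    (nonempty_addEquiv_of_prime_nsmul_eq_zero p.2 (fun x => Subtype.ext x.2)
      (fun x => Subtype.ext x.2) (hcard p p.2.pos)).some
  obtain ⟨φ, hφ⟩ := (Module.Baer.of_divisible H).extension_property_addMonoidHom _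
    (iSupIndep_ker_nsmul_prime G).dfinsuppSumAddHom_injective
    (DFinsupp.sumAddHom fun p => (nsmulAddMonoidHom (α := H) (p : ℕ)).ker.subtype.comp
      (e p).toAddMonoidHom)
  have hφe : ∀ (p : Nat.Primes) (x : (nsmulAddMonoidHom (α := G) (p : ℕ)).ker),
      φ x = e p x := fun p x => by
    have := DFunLike.congr_fun hφ (DFinsupp.single p x)
    simpa using this
  have hprime : ∀ (p : ℕ), p.Prime → ∀ x : G, p • x = 0 → φ x = 0 → x = 0 := fun p hp x hx h0 => by
    have := hφe ⟨p, hp⟩ ⟨x, hx⟩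
    rw [h0, eq_comm, ZeroMemClass.coe_eq_zero, map_eq_zero_iff _ (e ⟨p, hp⟩).injective] at this
    exact congrArg Subtype.val this
  have hinj : Function.Injective φ := by
    rw [injective_iff_map_eq_zero]
    intro x hx
    by_contra hne
    obtain ⟨n, hn, hnx⟩ := hG x
    have hord : addOrderOf x ≠ 1 := fun h => hne (AddMonoid.addOrderOf_eq_one_iff.1 h)
    obtain ⟨p, hp, k, hk⟩ := Nat.exists_prime_and_dvd hord
    have hzero : k • x = 0 := hprime p hp _
      (by rw [← mul_smul, ← hk, addOrderOf_nsmul_eq_zero]) (by rw [map_nsmul, hx, smul_zero])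
    have hpos : 0 < addOrderOf x :=
      Nat.pos_of_dvd_of_pos (addOrderOf_dvd_iff_nsmul_eq_zero.2 hnx) hn
    have hk0 : 0 < k := Nat.pos_of_ne_zero fun h => by rw [h, mul_zero] at hk; omega
    have := Nat.le_of_dvd hk0 (addOrderOf_dvd_iff_nsmul_eq_zero.2 hzero)
    have := hp.two_le
    nlinarith
  refine ⟨AddEquiv.ofBijective φ ⟨hinj, fun y => ?_⟩⟩
  obtain ⟨n, hn, hny⟩ := hH y
  have := hfin n hn
  have : Finite (nsmulAddMonoidHom (α := H) n).ker :=
    Nat.finite_of_card_ne_zero (hcard n hn ▸ Nat.card_pos.ne')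
  let ψ : (nsmulAddMonoidHom (α := G) n).ker → (nsmulAddMonoidHom (α := H) n).ker := fun x =>
    ⟨φ x, show n • φ x = 0 by rw [← map_nsmul, show n • (x : G) = 0 from x.2, map_zero]⟩
  have hψ : Function.Injective ψ := fun x y h => Subtype.ext (hinj (Subtype.ext_iff.1 h))
  obtain ⟨x, hx⟩ := (hψ.bijective_of_nat_card_le (hcard n hn).ge).2 ⟨y, hny⟩
  exact ⟨x, Subtype.ext_iff.1 hx⟩

/-- A mild torsion group is the direct sum of some `(ℚ/ℤ)^a` and a finite group. -/
lemma IsMild.exists_addEquiv_of_torsion {A : Type u} [AddCommGroup A] (hA : IsMild A)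
    (htor : ∀ x : A, ∃ n : ℕ, 0 < n ∧ n • x = 0) :
    ∃ (a : ℕ) (T : Type u) (_ : AddCommGroup T), Finite T ∧
      Nonempty (A ≃+ (Fin a → QmodZ) × T) := by
  obtain ⟨a, r, V, T, _, _, hV, hT, ⟨e⟩⟩ := hA
  have htor' : ∀ y : V × (Fin a → QmodZ) × (Fin r → ℤ) × T, ∃ n : ℕ, 0 < n ∧ n • y = 0 :=
    fun y => by
      obtain ⟨n, hn, h⟩ := htor (e.symm y)
      exact ⟨n, hn, by simpa [← map_nsmul] using h⟩
  have : Subsingleton V := subsingleton_of_forall_eq 0 fun v => by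
    obtain ⟨n, hn, h⟩ := htor' (v, 0)
    exact (hV 0 n hn).unique (congrArg Prod.fst h) (smul_zero n)
  have : Subsingleton (Fin r → ℤ) := subsingleton_of_forall_eq 0 fun z => by
    obtain ⟨n, hn, h⟩ := htor' (0, 0, z, 0)
    have h' : n • z = 0 := congrArg (fun y => y.2.2.1) h
    exact (smul_eq_zero.1 h').resolve_left hn.ne'
  let _ : Unique V := uniqueOfSubsingleton 0
  let _ : Unique (Fin r → ℤ) := uniqueOfSubsingleton 0
  exact ⟨a, T, _, hT, ⟨e.trans (AddEquiv.uniqueProd.trans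
    ((AddEquiv.refl _).prodCongr AddEquiv.uniqueProd))⟩⟩

/-- If `A` is a mild abelian group, `B` is a mild abelian group which is
divisible and torsion (equivalently, `B ≅ (ℚ/ℤ)^s` for some `s ∈ ℕ`), and `f : A → B` is an
injective homomorphism, then `coker f` is mild. -/
theorem cokernel_of_injective_into_divisible_torsion_isMild
    {A B : Type u} [AddCommGroup A] [AddCommGroup B]
    (hA : IsMild A) (hB : ∃ s : ℕ, Nonempty (B ≃+ (Fin s → QmodZ)))
    (f : A →+ B) (hf : Function.Injective f) :
    IsMild (B ⧸ f.range) := by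
  obtain ⟨s, ⟨eB⟩⟩ := hB
  have hBtor : ∀ b : B, ∃ n : ℕ, 0 < n ∧ n • b = 0 := fun b => by
    obtain ⟨n, hn, h⟩ := exists_nsmul_eq_zero_pi_qmodZ s (eB b)
    exact ⟨n, hn, by rwa [← map_nsmul, map_eq_zero_iff _ eB.injective] at h⟩
  have hBdiv : ∀ n : ℕ, 0 < n → Function.Surjective (nsmulAddMonoidHom (α := B) n) :=
    fun n hn b => by
      obtain ⟨x, hx⟩ := nsmul_pi_qmodZ_surjective s hn (eB b)
      exact ⟨eB.symm x, by
        rw [nsmulAddMonoidHom_apply, ← map_nsmul, AddEquiv.symm_apply_eq]; exact hx⟩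
  obtain ⟨a, T, _, hT, ⟨eA⟩⟩ := hA.exists_addEquiv_of_torsion fun x => by
    obtain ⟨n, hn, h⟩ := hBtor (f x)
    exact ⟨n, hn, by rwa [← map_nsmul, map_eq_zero_iff f hf] at h⟩
  have eR : f.range ≃+ (Fin a → QmodZ) × T := (AddMonoidHom.ofInjective hf).symm.trans eA
  have hcount : ∀ n : ℕ, 0 < n →
      Nat.card (nsmulAddMonoidHom (α := B ⧸ f.range) n).ker * n ^ a = n ^ s := fun n hn => by
    have h := natCard_ker_nsmul_quotient f.range n (hBdiv n hn)
    rw [eR.natCard_ker_nsmul, eR.index_range_nsmul_eq, eB.natCard_ker_nsmul,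
      natCard_ker_nsmul_prod, index_range_nsmul_prod, natCard_ker_nsmul_pi_qmodZ a hn,
      natCard_ker_nsmul_pi_qmodZ s hn,
      AddMonoidHom.range_eq_top.2 (nsmul_pi_qmodZ_surjective a hn), AddSubgroup.index_top, one_mul,
      ← natCard_ker_nsmul_eq_index_range, ← mul_assoc, mul_comm _ (n ^ s)] at h
    exact Nat.eq_of_mul_eq_mul_right Nat.card_pos h
  have has : a ≤ s := (Nat.pow_dvd_pow_iff_le_right (x := 2) one_lt_two).1
    (Dvd.intro_left _ (hcount 2 two_pos))
  have hcard : ∀ n : ℕ, 0 < n → Nat.card (nsmulAddMonoidHom (α := B ⧸ f.range) n).ker =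
      n ^ (s - a) := fun n hn =>
    Nat.eq_of_mul_eq_mul_right (pow_pos hn a)
      (by rw [hcount n hn, ← pow_add, Nat.sub_add_cancel has])
  have hmk := QuotientAddGroup.mk'_surjective f.range
  obtain ⟨e⟩ := nonempty_addEquiv_of_natCard_ker_nsmul_eq (G := B ⧸ f.range)
    (H := Fin (s - a) → QmodZ)
    (hmk.forall.2 fun b => by
      obtain ⟨n, hn, h⟩ := hBtor b
      exact ⟨n, hn, by rw [← map_nsmul, h, map_zero]⟩)
    (exists_nsmul_eq_zero_pi_qmodZ _) (fun n hn => nsmul_pi_qmodZ_surjective _ hn)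
    (fun n hn => Nat.finite_of_card_ne_zero (by rw [hcard n hn]; positivity))
    (fun n hn => by rw [hcard n hn, natCard_ker_nsmul_pi_qmodZ _ hn])
  refine ⟨s - a, 0, PUnit, PUnit, inferInstance, inferInstance,
    fun v n _ => ⟨v, Subsingleton.elim _ _, fun _ _ => Subsingleton.elim _ _⟩, inferInstance, ⟨?_⟩⟩
  let _ : Unique ((Fin 0 → ℤ) × PUnit.{u + 1}) := uniqueOfSubsingleton 0
  exact e.trans (AddEquiv.prodUnique.symm.trans AddEquiv.uniqueProd.symm)
end
end

section
/- Let A be a mild abelian group, let B be a uniquely divisible abelian group (for every b ∈ B and every positive integer n there is a unique c ∈ B with n·c = b), and let f: A → B be an injective group homomorphism. Then the cokernel of f is a mild abelian group. -/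
noncomputable section

universe u v

open nonZeroDivisors in
/-- The rational vector space structure carried by a uniquely divisible abelian group. -/
@[reducible] def IsUniquelyDivisible.ratModule {V : Type*} [AddCommGroup V]
    (h : IsUniquelyDivisible V) : Module ℚ V :=
  haveI : IsLocalizedModule ℤ⁰ (LinearMap.id : V →ₗ[ℤ] V) :=
    { map_units := by
        intro x
        rw [Module.End.isUnit_iff]
        have hx : (x : ℤ) ≠ 0 := nonZeroDivisors.coe_ne_zero x
        have key : ∀ v : V, ∃! w : V, (x : ℤ) • w = v := by
          intro v
          rcases Int.natAbs_eq (x : ℤ) with hn | hn <;> rw [hn]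
          · simpa only [natCast_zsmul] using h v _ (Int.natAbs_pos.2 hx)
          · simpa only [neg_smul, natCast_zsmul, neg_eq_iff_eq_neg] using h (-v) _ (Int.natAbs_pos.2 hx)
        exact (Function.bijective_iff_existsUnique _).2 key
      surj := fun y => ⟨(y, 1), by simp⟩
      exists_of_eq := fun {x y} hxy => ⟨1, by simpa using hxy⟩ }
  IsLocalizedModule.module (A := ℚ) ℤ⁰ (LinearMap.id : V →ₗ[ℤ] V)

lemma isUniquelyDivisible_of_ratModule (V : Type*) [AddCommGroup V] [Module ℚ V] :
    IsUniquelyDivisible V := by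
  intro v n hn
  have hn' : (n : ℚ) ≠ 0 := by exact_mod_cast hn.ne'
  refine ⟨(n : ℚ)⁻¹ • v, ?_, ?_⟩
  · simp only [← Nat.cast_smul_eq_nsmul ℚ, smul_smul, mul_inv_cancel₀ hn', one_smul]
  · rintro w rfl
    simp only [← Nat.cast_smul_eq_nsmul ℚ, smul_smul, inv_mul_cancel₀ hn', one_smul]

lemma exists_pos_nsmul_eq_zero_QmodZ (q : QmodZ) : ∃ n : ℕ, 0 < n ∧ n • q = 0 := by
  induction q using QuotientAddGroup.induction_on with
  | H q =>
    refine ⟨q.den, q.den_pos, ?_⟩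
    rw [← QuotientAddGroup.mk_nsmul]
    refine (AddCircle.coe_eq_zero_iff (1 : ℚ)).2 ⟨q.num, ?_⟩
    simp [Rat.den_mul_eq_num]

lemma AddMonoidHom.eq_zero_of_torsion {T B : Type*} [AddCommGroup T] [AddCommGroup B]
    [IsAddTorsionFree B] (hT : ∀ t : T, ∃ n : ℕ, 0 < n ∧ n • t = 0) (f : T →+ B) : f = 0 := by
  ext t
  obtain ⟨n, hn, ht⟩ := hT t
  have := congrArg f ht
  rw [map_nsmul, map_zero] at this
  exact (smul_eq_zero_iff_right hn.ne').1 this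

/-- If `z` is a finite family of vectors of a rational vector space `B` that is linearly independent
modulo a subspace `W`, the quotient of `B` by `W + ∑ ℤ zᵢ` is mild. -/
lemma isMild_quotient_of_linearIndependent {B : Type u} [AddCommGroup B] [Module ℚ B]
    (W : Submodule ℚ B) {r : ℕ} (z : Fin r → B)
    (hz : LinearIndependent ℚ fun i => W.mkQ (z i)) (H : AddSubgroup B)
    (hH : ∀ b, b ∈ H ↔ ∃ n : Fin r → ℤ, b - ∑ i, n i • z i ∈ W) :
    IsMild (B ⧸ H) := by
  set g := Fintype.linearCombination ℚ fun i => W.mkQ (z i) with hg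
  have hker : LinearMap.ker g = ⊥ := LinearMap.ker_eq_bot.2 hz.fintypeLinearCombination_injective
  obtain ⟨l, hl⟩ := g.exists_leftInverse_of_injective hker
  have hlg : ∀ q, l (g q) = q := fun q => LinearMap.congr_fun hl q
  have hgn : ∀ n : Fin r → ℤ, g (fun i => (n i : ℚ)) = W.mkQ (∑ i, n i • z i) := by
    intro n
    simp [hg, Fintype.linearCombination_apply, Int.cast_smul_eq_zsmul]
  let p : (B ⧸ W) →ₗ[ℚ] LinearMap.ker l :=
    (LinearMap.id - g ∘ₗ l).codRestrict _ fun x => by simp [hlg]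
  let m : (Fin r → ℚ) →+ (Fin r → QmodZ) :=
    AddMonoidHom.piMap fun _ => QuotientAddGroup.mk' (AddSubgroup.zmultiples (1 : ℚ))
  let φ : B →+ LinearMap.ker l × (Fin r → QmodZ) :=
    (p.toAddMonoidHom.prod (m.comp l.toAddMonoidHom)).comp W.mkQ.toAddMonoidHom
  have hm : ∀ q, m q = 0 ↔ ∃ n : Fin r → ℤ, (fun i => (n i : ℚ)) = q := by
    intro q
    have : m q = 0 ↔ ∀ i, ∃ k : ℤ, (k : ℚ) = q i := by
      rw [funext_iff]
      refine forall_congr' fun i => ?_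
      refine (AddCircle.coe_eq_zero_iff (1 : ℚ)).trans ?_
      simp
    rw [this, Classical.skolem]
    simp only [funext_iff]
  have hsurj : Function.Surjective φ := by
    rintro ⟨⟨c, hc⟩, q⟩
    obtain ⟨q, rfl⟩ : ∃ q', m q' = q := by
      choose q' hq' using fun i => QuotientAddGroup.mk_surjective (q i)
      exact ⟨q', funext hq'⟩
    obtain ⟨b, hb⟩ := W.mkQ_surjective (c + g q)
    have hc' : l c = 0 := hc
    have hlb : l (W.mkQ b) = q := by rw [hb, map_add, hc', hlg, zero_add]
    refine ⟨b, Prod.ext (Subtype.ext ?_) ?_⟩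
    · change W.mkQ b - g (l (W.mkQ b)) = c
      rw [hlb, hb, add_sub_cancel_right]
    · change m (l (W.mkQ b)) = m q
      rw [hlb]
  have hφ : H = φ.ker := by
    ext b
    have h1 : b ∈ φ.ker ↔ W.mkQ b - g (l (W.mkQ b)) = 0 ∧ m (l (W.mkQ b)) = 0 := by
      rw [AddMonoidHom.mem_ker, Prod.ext_iff, Subtype.ext_iff]
      rfl
    have h2 : ∀ n : Fin r → ℤ,
        b - ∑ i, n i • z i ∈ W ↔ W.mkQ b = g (fun i => (n i : ℚ)) := by
      intro n
      rw [hgn, ← sub_eq_zero, ← map_sub, Submodule.mkQ_apply, Submodule.Quotient.mk_eq_zero]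
    rw [hH, h1, hm]
    simp only [h2]
    constructor
    · rintro ⟨n, hn⟩
      rw [hn, hlg]
      exact ⟨sub_self _, n, rfl⟩
    · rintro ⟨h, n, hn⟩
      exact ⟨n, by rw [hn]; exact sub_eq_zero.1 h⟩
  let e : (B ⧸ H) ≃+ LinearMap.ker l × (Fin r → QmodZ) :=
    (QuotientAddGroup.quotientAddEquivOfEq hφ).trans
      (QuotientAddGroup.quotientKerEquivOfSurjective φ hsurj)
  refine ⟨r, 0, LinearMap.ker l, PUnit, inferInstance, inferInstance,
    isUniquelyDivisible_of_ratModule _, inferInstance, ⟨e.trans ?_⟩⟩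
  let : Unique ((Fin 0 → ℤ) × PUnit.{u + 1}) := Unique.mk' _
  exact (AddEquiv.refl _).prodCongr
    (AddEquiv.prodUnique (N := (Fin 0 → ℤ) × PUnit.{u + 1})).symm

/-- If `A` is a mild abelian group, `B` is a uniquely divisible abelian
group, and `f : A → B` is an injective homomorphism, then `coker f` is mild. -/
theorem cokernel_of_injective_into_uniquely_divisible_isMild
    {A B : Type u} [AddCommGroup A] [AddCommGroup B]
    (hA : IsMild A) (hB : IsUniquelyDivisible B)
    (f : A →+ B) (hf : Function.Injective f) :
    IsMild (B ⧸ f.range) := by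
  obtain ⟨s, r, V, T, _, _, hV, _, ⟨e⟩⟩ := hA
  let := hB.ratModule
  let := hV.ratModule
  have : IsAddTorsionFree B := IsAddTorsionFree.of_module_rat B
  let F : V × (Fin s → QmodZ) × (Fin r → ℤ) × T →+ B := f.comp e.symm.toAddMonoidHom
  have hF : Function.Injective F := hf.comp e.symm.injective
  let fV : V →+ B := F.comp (AddMonoidHom.inl _ _)
  let fD : (Fin s → QmodZ) →+ B := (F.comp (AddMonoidHom.inr _ _)).comp (AddMonoidHom.inl _ _)
  let fZ : (Fin r → ℤ) →+ B :=
    ((F.comp (AddMonoidHom.inr _ _)).comp (AddMonoidHom.inr _ _)).comp (AddMonoidHom.inl _ _)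
  let fT : T →+ B :=
    ((F.comp (AddMonoidHom.inr _ _)).comp (AddMonoidHom.inr _ _)).comp (AddMonoidHom.inr _ _)
  have hD : fD = 0 := by
    refine AddMonoidHom.functions_ext' _ _ _ fun i => ?_
    rw [AddMonoidHom.zero_comp]
    exact AddMonoidHom.eq_zero_of_torsion exists_pos_nsmul_eq_zero_QmodZ _
  have hT : fT = 0 := AddMonoidHom.eq_zero_of_torsion
    (fun t => ⟨Nat.card T, Nat.card_pos, card_nsmul_eq_zero'⟩) _
  have hFsum : ∀ v d n t, F (v, d, n, t) = fV v + fZ n := by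
    intro v d n t
    have h : F (v, d, n, t) = fV v + fD d + fZ n + fT t := by
      simp only [fV, fD, fZ, fT, AddMonoidHom.comp_apply, ← map_add]
      simp
    rw [h, hD, hT]
    simp
  let z : Fin r → B := fun i => fZ (Pi.single i 1)
  have hfZ : ∀ n, fZ n = ∑ i, n i • z i := by
    intro n
    conv_lhs => rw [← Finset.univ_sum_single n]
    rw [map_sum]
    refine Finset.sum_congr rfl fun i _ => ?_
    rw [← map_zsmul, ← Pi.single_smul, smul_eq_mul, mul_one]
  let W : Submodule ℚ B := LinearMap.range fV.toRatLinearMap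
  have hW : ∀ b, b ∈ W ↔ ∃ v, fV v = b := fun b => Iff.rfl
  refine isMild_quotient_of_linearIndependent W z ?_ _ fun b => ?_
  · rw [← LinearIndependent.iff_fractionRing ℤ ℚ, Fintype.linearIndependent_iff]
    intro n hn
    have hn' : ∑ i, n i • z i ∈ W := by
      rw [← Submodule.Quotient.mk_eq_zero, ← Submodule.mkQ_apply, map_sum, ← hn]
      simp only [map_zsmul]
    obtain ⟨v, hv⟩ := (hW _).1 hn'
    have h0 : F (-v, 0, n, 0) = F 0 := by
      rw [hFsum, map_neg, hv, hfZ, map_zero, neg_add_cancel]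
    have := congrArg (fun x => x.2.2.1) (hF h0)
    exact fun i => congrFun this i
  · constructor
    · rintro ⟨a, rfl⟩
      obtain ⟨⟨v, d, n, t⟩, rfl⟩ := e.symm.surjective a
      refine ⟨n, (hW _).2 ⟨v, ?_⟩⟩
      rw [← hfZ]
      exact eq_sub_of_add_eq (hFsum v d n t).symm
    · rintro ⟨n, hn⟩
      obtain ⟨v, hv⟩ := (hW _).1 hn
      refine ⟨e.symm (v, 0, n, 0), (hFsum v 0 n 0).trans ?_⟩
      rw [hv, hfZ, sub_add_cancel]
end
end

section
/- An abelian group G is mild if and only if the quotient G/G_div is a finitely generated abelian group and there exists a nonnegative integer s such that for every positive integer n the number of n-torsion elements of G_div is equal to n^s. -/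
noncomputable section

universe u v

lemma card_torsion_QmodZ {n : ℕ} (hn : 0 < n) : Nat.card {x : QmodZ // n • x = 0} = n := by
  have hn' : (n : ℚ) ≠ 0 := by exact_mod_cast hn.ne'
  let f : Fin n → {x : QmodZ // n • x = 0} := fun m =>
    ⟨((m : ℚ) / n * 1 : ℚ), (AddCircle.nsmul_eq_zero_iff hn).2 ⟨m, m.2, rfl⟩⟩
  have hf : Function.Bijective f := by
    constructor
    · intro a b hab
      have h : (((a : ℚ) / n * 1 : ℚ) : QmodZ) = ((b : ℚ) / n * 1 : ℚ) := congrArg Subtype.val hab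
      rw [← sub_eq_zero, ← AddCircle.coe_sub, AddCircle.coe_eq_zero_iff] at h
      obtain ⟨k, hk⟩ := h
      have hk' : (k : ℚ) * n = a - b := by
        simp only [zsmul_eq_mul, mul_one] at hk
        rw [hk]
        field_simp
      have hz : k * (n : ℤ) = (a : ℤ) - b := by exact_mod_cast hk'
      have hk0 : k = 0 := by
        have h1 : k * (n : ℤ) < 1 * n := by omega
        have h2 : (-1) * (n : ℤ) < k * n := by omega
        have h1' := lt_of_mul_lt_mul_right h1 (by omega)
        have h2' := lt_of_mul_lt_mul_right h2 (by omega)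
        omega
      subst hk0
      ext
      omega
    · rintro ⟨x, hx⟩
      obtain ⟨m, hm, rfl⟩ := (AddCircle.nsmul_eq_zero_iff hn).1 hx
      exact ⟨⟨m, hm⟩, rfl⟩
  rw [← Nat.card_congr (Equiv.ofBijective f hf), Nat.card_fin]

lemma card_torsion_QmodZ_pow (s : ℕ) {n : ℕ} (hn : 0 < n) :
    Nat.card {x : Fin s → QmodZ // n • x = 0} = n ^ s := by
  have e : {x : Fin s → QmodZ // n • x = 0} ≃ (Fin s → {x : QmodZ // n • x = 0}) :=
    (Equiv.subtypeEquivRight fun x => by simp [funext_iff]).trans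
      (Equiv.subtypePiEquivPi (p := fun _ (x : QmodZ) => n • x = 0))
  rw [Nat.card_congr e, Nat.card_fun, card_torsion_QmodZ hn, Nat.card_fin]

lemma exists_nsmul_eq_QmodZ (x : QmodZ) {n : ℕ} (hn : 0 < n) : ∃ y : QmodZ, n • y = x := by
  have hn' : (n : ℚ) ≠ 0 := by exact_mod_cast hn.ne'
  induction x using QuotientAddGroup.induction_on with
  | H q =>
    refine ⟨((q / n : ℚ) : QmodZ), ?_⟩
    rw [← AddCircle.coe_nsmul, nsmul_eq_mul, mul_div_cancel₀ _ hn']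

lemma exists_nsmul_eq_QmodZ_pow {s : ℕ} (x : Fin s → QmodZ) {n : ℕ} (hn : 0 < n) :
    ∃ y : Fin s → QmodZ, n • y = x := by
  choose y hy using fun i => exists_nsmul_eq_QmodZ (x i) hn
  exact ⟨y, funext hy⟩

/-- Abelian groups in which every positive integer acts surjectively are injective. -/
lemma Module.Baer.of_forall_exists_nsmul_eq {A : Type*} [AddCommGroup A]
    (hA : ∀ n : ℕ, 0 < n → ∀ x : A, ∃ y : A, n • y = x) : Module.Baer ℤ A := by
  have hsurj : ∀ {n : ℤ}, n ≠ 0 → Function.Surjective fun a : A => n • a := by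
    intro n hn x
    obtain ⟨y, hy⟩ := hA n.natAbs (Int.natAbs_pos.2 hn) x
    rcases Int.natAbs_eq n with h | h
    · refine ⟨y, ?_⟩
      simp only
      rw [h, natCast_zsmul, hy]
    · refine ⟨-y, ?_⟩
      simp only
      rw [h, neg_smul, smul_neg, neg_neg, natCast_zsmul, hy]
  let _ : DivisibleBy A ℤ := divisibleByOfSMulRightSurj A ℤ hsurj
  exact Module.Baer.of_divisible A

/-- A surjection with divisible kernel splits. -/
lemma nonempty_addEquiv_ker_prod {B C : Type*} [AddCommGroup B] [AddCommGroup C]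
    (f : B →+ C) (hf : Function.Surjective f)
    (hdiv : ∀ n : ℕ, 0 < n → ∀ x : f.ker, ∃ y : f.ker, n • y = x) :
    Nonempty (B ≃+ f.ker × C) := by
  obtain ⟨r, hr⟩ := (Module.Baer.of_forall_exists_nsmul_eq hdiv).extension_property_addMonoidHom
    f.ker.subtype f.ker.subtype_injective (AddMonoidHom.id _)
  have hr' : ∀ x : f.ker, r x = x := fun x => DFunLike.congr_fun hr x
  refine ⟨AddEquiv.ofBijective (r.prod f) ⟨?_, ?_⟩⟩
  · rw [injective_iff_map_eq_zero]
    intro b hb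
    obtain ⟨h1, h2⟩ := Prod.mk.inj hb
    have h3 := hr' ⟨b, h2⟩
    exact congrArg Subtype.val (h3.symm.trans h1)
  · rintro ⟨a, c⟩
    obtain ⟨b, rfl⟩ := hf c
    have hk : f (a - r b : f.ker) = 0 := (a - r b).2
    refine ⟨b + (a - r b : f.ker), Prod.ext ?_ ?_⟩
    · change r (b + (a - r b : f.ker)) = a
      rw [map_add, hr']
      abel
    · change f (b + (a - r b : f.ker)) = f b
      rw [map_add, hk, add_zero]

lemma nonempty_linearEquiv_zmod_of_card_eq {A B : Type*} [AddCommGroup A] [AddCommGroup B]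
    (p : ℕ) [Fact p.Prime] [Module (ZMod p) A] [Module (ZMod p) B] [Finite A] [Finite B]
    (hcard : Nat.card A = Nat.card B) : Nonempty (A ≃ₗ[ZMod p] B) := by
  have h : Module.finrank (ZMod p) A = Module.finrank (ZMod p) B := by
    apply Nat.pow_right_injective (Fact.out : p.Prime).two_le
    simp only [FiniteField.pow_finrank_eq_natCard, hcard]
  exact ⟨(Module.finBasis (ZMod p) A).equiv (Module.finBasis (ZMod p) B) (finCongr h)⟩

/-- Two `p`-torsion groups of the same finite order `p ^ s` are isomorphic. -/
lemma nonempty_addEquiv_of_card_eq_prime_pow {A B : Type*} [AddCommGroup A] [AddCommGroup B]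
    {p s : ℕ} (hp : p.Prime) (hA : ∀ x : A, p • x = 0) (hB : ∀ x : B, p • x = 0)
    (cA : Nat.card A = p ^ s) (cB : Nat.card B = p ^ s) : Nonempty (A ≃+ B) := by
  have := Fact.mk hp
  have hpos : 0 < p ^ s := pow_pos hp.pos s
  have : Finite A := Nat.finite_of_card_ne_zero (by omega)
  have : Finite B := Nat.finite_of_card_ne_zero (by omega)
  let mA : Module (ZMod p) A := AddCommGroup.zmodModule hA
  let mB : Module (ZMod p) B := AddCommGroup.zmodModule hB
  obtain ⟨e⟩ := nonempty_linearEquiv_zmod_of_card_eq p (cA.trans cB.symm)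
  exact ⟨e.toAddEquiv⟩

lemma nsmul_torsionBy_eq_zero {A : Type*} [AddCommGroup A] {n : ℕ}
    (x : Submodule.torsionBy ℤ A (n : ℤ)) : n • x = 0 := by
  have h : (n : ℤ) • (x : A) = 0 := x.2
  rw [natCast_zsmul] at h
  exact Subtype.ext h

lemma card_torsionBy {A : Type*} [AddCommGroup A] (n : ℕ) :
    Nat.card (Submodule.torsionBy ℤ A (n : ℤ)) = Nat.card {x : A // n • x = 0} :=
  Nat.card_congr (Equiv.subtypeEquivRight fun x => by simp)

lemma iSupIndep_torsionBy_primes (D : Type*) [AddCommGroup D] :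
    iSupIndep fun p : Nat.Primes => Submodule.torsionBy ℤ D ((p : ℕ) : ℤ) := by
  rw [iSupIndep_iff_supIndep]
  intro S
  apply Submodule.supIndep_torsionBy
  intro p _ q _ hpq
  exact Nat.isCoprime_iff_coprime.2
    ((Nat.coprime_primes p.2 q.2).2 fun h => hpq (Subtype.ext h))

/-- A group with `p ^ s` elements killed by each prime `p` maps to `(ℚ/ℤ)^s` with torsion-free
kernel. -/
lemma exists_hom_QmodZ_pow_ker_torsionFree {D : Type*} [AddCommGroup D] {s : ℕ}
    (hcard : ∀ p : ℕ, p.Prime → Nat.card {x : D // p • x = 0} = p ^ s) :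
    ∃ f : D →+ (Fin s → QmodZ), ∀ n : ℕ, 0 < n → ∀ x : D, f x = 0 → n • x = 0 → x = 0 := by
  classical
  have key : ∀ p : Nat.Primes, ∃ g : Submodule.torsionBy ℤ D ((p : ℕ) : ℤ) →ₗ[ℤ] (Fin s → QmodZ),
      Function.Injective g := by
    intro p
    obtain ⟨e⟩ := nonempty_addEquiv_of_card_eq_prime_pow (s := s) p.2
      (nsmul_torsionBy_eq_zero (A := D)) (nsmul_torsionBy_eq_zero (A := Fin s → QmodZ))
      ((card_torsionBy p).trans (hcard p p.2))
      ((card_torsionBy p).trans (card_torsion_QmodZ_pow s p.2.pos))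
    exact ⟨(Submodule.subtype _).comp e.toIntLinearEquiv.toLinearMap,
      (Submodule.subtype_injective _).comp e.injective⟩
  choose g hg using key
  obtain ⟨f, hf⟩ := (Module.Baer.of_forall_exists_nsmul_eq
    fun n hn (x : Fin s → QmodZ) => exists_nsmul_eq_QmodZ_pow x hn).extension_property
      _ (iSupIndep_torsionBy_primes D).dfinsupp_lsum_injective (DFinsupp.lsum ℕ g)
  have hfg : ∀ (p : Nat.Primes) (x : Submodule.torsionBy ℤ D ((p : ℕ) : ℤ)), f x = g p x := by
    intro p x
    have h := LinearMap.congr_fun hf (DFinsupp.single p x)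
    simpa using h
  refine ⟨f.toAddMonoidHom, fun n => ?_⟩
  induction n using Nat.recOnMul with
  | zero => exact fun h => absurd h (lt_irrefl 0)
  | one => exact fun _ x _ hx => by simpa using hx
  | prime p hp =>
    intro _ x hfx hx
    obtain ⟨q, rfl⟩ : ∃ q : Nat.Primes, (q : ℕ) = p := ⟨⟨p, hp⟩, rfl⟩
    have hmem : x ∈ Submodule.torsionBy ℤ D ((q : ℕ) : ℤ) := by simpa using hx
    have h0 : g q ⟨x, hmem⟩ = g q 0 := (hfg q ⟨x, hmem⟩).symm.trans (hfx.trans (map_zero _).symm)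
    exact congrArg Subtype.val (hg q h0)
  | mul a b iha ihb =>
    intro hab x hfx hx
    refine ihb (Nat.pos_of_mul_pos_left hab) x hfx
      (iha (Nat.pos_of_mul_pos_right hab) (b • x) ?_ ?_)
    · rw [map_nsmul, hfx, smul_zero]
    · rw [← mul_smul, hx]

/-- A divisible group with `n ^ s` elements killed by each `n > 0` is the product of a uniquely
divisible group and `(ℚ/ℤ)^s`. -/
lemma exists_addEquiv_uniquelyDivisible_prod {D : Type u} [AddCommGroup D] {s : ℕ}
    (hdiv : ∀ n : ℕ, 0 < n → ∀ x : D, ∃ y : D, n • y = x)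
    (hcard : ∀ n : ℕ, 0 < n → Nat.card {x : D // n • x = 0} = n ^ s) :
    ∃ (V : Type u) (_ : AddCommGroup V),
      IsUniquelyDivisible V ∧ Nonempty (D ≃+ V × (Fin s → QmodZ)) := by
  obtain ⟨f, hf⟩ := exists_hom_QmodZ_pow_ker_torsionFree fun p hp => hcard p hp.pos
  have hlift : ∀ n : ℕ, 0 < n → ∀ y : Fin s → QmodZ, n • y = 0 → ∃ x : D, n • x = 0 ∧ f x = y := by
    intro n hn y hy
    have hpos : 0 < n ^ s := pow_pos hn s
    have : Finite {x : Fin s → QmodZ // n • x = 0} :=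
      Nat.finite_of_card_ne_zero (by rw [card_torsion_QmodZ_pow s hn]; omega)
    let φ : {x : D // n • x = 0} → {x : Fin s → QmodZ // n • x = 0} :=
      fun x => ⟨f x, by rw [← map_nsmul, x.2, map_zero]⟩
    have hφ : Function.Injective φ := by
      intro a b hab
      have h : f a = f b := congrArg Subtype.val hab
      refine Subtype.ext (sub_eq_zero.1 (hf n hn _ ?_ ?_))
      · rw [map_sub, h, sub_self]
      · rw [smul_sub, a.2, b.2, sub_self]
    have hbij := (Function.Injective.bijective_of_nat_card_le hφ
      (by rw [card_torsion_QmodZ_pow s hn, hcard n hn]))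
    obtain ⟨x, hx⟩ := hbij.2 ⟨y, hy⟩
    exact ⟨x, x.2, congrArg Subtype.val hx⟩
  have hsurj : Function.Surjective f := by
    intro y
    have htor : ∀ z : QmodZ, ∃ n : ℕ, 0 < n ∧ n • z = 0 := by
      intro z
      induction z using QuotientAddGroup.induction_on with
      | H q =>
        refine ⟨q.den, q.pos, ?_⟩
        have h : (q.den • (q : QmodZ)) = 0 := by
          rw [← AddCircle.coe_nsmul, AddCircle.coe_eq_zero_iff]
          exact ⟨q.num, by rw [nsmul_eq_mul, mul_comm, Rat.mul_den_eq_num]; simp⟩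
        exact h
    choose N hN hNy using fun i => htor (y i)
    obtain ⟨x, -, hx⟩ := hlift (∏ i, N i) (Finset.prod_pos fun i _ => hN i) y (by
      funext i
      obtain ⟨c, hc⟩ := Finset.dvd_prod_of_mem N (Finset.mem_univ i)
      rw [Pi.smul_apply, hc, mul_comm, mul_smul, hNy, smul_zero, Pi.zero_apply])
    exact ⟨x, hx⟩
  have hkdiv : ∀ n : ℕ, 0 < n → ∀ x : f.ker, ∃ y : f.ker, n • y = x := by
    intro n hn x
    obtain ⟨d, hd⟩ := hdiv n hn x
    obtain ⟨t, ht, hft⟩ := hlift n hn (f d) (by rw [← map_nsmul, hd]; exact x.2)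
    exact ⟨⟨d - t, by rw [AddMonoidHom.mem_ker, map_sub, hft, sub_self]⟩,
      Subtype.ext (by simp [smul_sub, hd, ht])⟩
  refine ⟨f.ker, inferInstance, fun v n hn => ?_, nonempty_addEquiv_ker_prod f hsurj hkdiv⟩
  obtain ⟨w, hw⟩ := hkdiv n hn v
  refine ⟨w, hw, fun w' hw' => ?_⟩
  refine Subtype.ext (sub_eq_zero.1 (hf n hn (w' - w : f.ker) (w' - w).2 ?_))
  rw [← AddSubgroup.coe_nsmul, smul_sub, hw, hw', sub_self, AddSubgroup.coe_zero]

lemma exists_addEquiv_free_prod_finite (Q : Type u) [AddCommGroup Q] [AddGroup.FG Q] :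
    ∃ (r : ℕ) (T : Type u) (_ : AddCommGroup T),
      Finite T ∧ Nonempty (Q ≃+ (Fin r → ℤ) × T) := by
  obtain ⟨r, ι, _, p, hp, e, ⟨φ⟩⟩ := AddCommGroup.equiv_free_prod_directSum_zmod Q
  have : ∀ i, NeZero (p i ^ e i) := fun i => ⟨pow_ne_zero _ (hp i).ne_zero⟩
  let ψ := DirectSum.addEquivProd fun i => ZMod (p i ^ e i)
  refine ⟨r, ULift.{u} (∀ i, ZMod (p i ^ e i)), inferInstance, inferInstance, ⟨φ.trans ?_⟩⟩
  exact AddEquiv.prodCongr (Finsupp.linearEquivFunOnFinite ℤ ℤ (Fin r)).toAddEquiv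
    (ψ.trans AddEquiv.ulift.symm)

/-- If `G / G_div` is finitely generated, then `G_div` is a divisible group. -/
lemma divisibleSubgroup_exists_nsmul_eq {G : Type u} [AddCommGroup G]
    [AddGroup.FG (G ⧸ divisibleSubgroup G)] (n : ℕ) (hn : 0 < n) (x : divisibleSubgroup G) :
    ∃ y : divisibleSubgroup G, n • y = x := by
  obtain ⟨r, T, _, _, ⟨φ⟩⟩ := exists_addEquiv_free_prod_finite (G ⧸ divisibleSubgroup G)
  have hm : 0 < Nat.card T := Nat.card_pos
  obtain ⟨h, hh⟩ := x.2 (n * Nat.card T) (Nat.mul_pos hn hm)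
  have hmem : Nat.card T • h ∈ divisibleSubgroup G := by
    rw [← QuotientAddGroup.eq_zero_iff]
    have h0 : (n * Nat.card T) • φ (h : G ⧸ divisibleSubgroup G) = 0 := by
      rw [← map_nsmul, ← QuotientAddGroup.mk_nsmul, hh,
        (QuotientAddGroup.eq_zero_iff _).2 x.2, map_zero]
    have h1 : (φ (h : G ⧸ divisibleSubgroup G)).1 = 0 :=
      (smul_eq_zero.1 (congrArg Prod.fst h0)).resolve_left (Nat.mul_pos hn hm).ne'
    apply φ.injective
    rw [QuotientAddGroup.mk_nsmul, map_nsmul, map_zero]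
    refine Prod.ext ?_ ?_
    · rw [Prod.smul_fst, h1, smul_zero, Prod.fst_zero]
    · exact card_nsmul_eq_zero'
  exact ⟨⟨_, hmem⟩, Subtype.ext (by simpa [mul_smul] using hh)⟩

/-- In `V × (ℚ/ℤ)^s × ℤ^r × T` the divisible elements are those with trivial last components. -/
lemma mem_divisibleSubgroup_iff_of_addEquiv {G V T : Type*} [AddCommGroup G] [AddCommGroup V]
    [AddCommGroup T] [Finite T] (hV : IsUniquelyDivisible V) {s r : ℕ}
    (e : G ≃+ V × (Fin s → QmodZ) × (Fin r → ℤ) × T) (g : G) :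
    g ∈ divisibleSubgroup G ↔ (e g).2.2 = 0 := by
  rw [mem_divisibleSubgroup]
  constructor
  · intro hg
    refine Prod.ext (funext fun i => ?_) ?_
    · obtain ⟨h, hh⟩ := hg (((e g).2.2.1 i).natAbs + 1) (Nat.succ_pos _)
      have h1 : (e g).2.2.1 i = ((((e g).2.2.1 i).natAbs + 1 : ℕ) : ℤ) * (e h).2.2.1 i := by
        conv_lhs => rw [← hh, map_nsmul]
        simp
      exact Int.eq_zero_of_abs_lt_dvd (Dvd.intro _ h1.symm) (by
        push_cast
        exact lt_add_one _)
    · obtain ⟨h, hh⟩ := hg (Nat.card T) Nat.card_pos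
      rw [← hh, map_nsmul]
      exact card_nsmul_eq_zero'
  · intro hg n hn
    obtain ⟨v, hv, -⟩ := hV (e g).1 n hn
    obtain ⟨y, hy⟩ := exists_nsmul_eq_QmodZ_pow (e g).2.1 hn
    refine ⟨e.symm (v, y, 0), e.injective ?_⟩
    rw [map_nsmul, e.apply_symm_apply]
    exact Prod.ext hv (Prod.ext hy ((smul_zero n).trans hg.symm))

/-- An abelian group `G` is mild if and only if `G/G_div` is finitely
generated and there is a nonnegative integer `s` such that for every positive integer `n`
the number of `n`-torsion elements of `G_div` equals `n ^ s`. -/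
theorem isMild_iff_quotient_fg_and_torsion_count
    {G : Type u} [AddCommGroup G] :
    IsMild G ↔
      (AddGroup.FG (G ⧸ divisibleSubgroup G) ∧
        ∃ s : ℕ, ∀ n : ℕ, 0 < n →
          Nat.card {x : divisibleSubgroup G // n • x = 0} = n ^ s) := by
  constructor
  · rintro ⟨s, r, V, T, _, _, hV, _, ⟨e⟩⟩
    have hmem := mem_divisibleSubgroup_iff_of_addEquiv hV e
    refine ⟨?_, s, fun n hn => ?_⟩
    · let π : G →+ (Fin r → ℤ) × T := ((AddMonoidHom.snd _ _).comp (AddMonoidHom.snd _ _)).comp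
        e.toAddMonoidHom
      have hker : divisibleSubgroup G = π.ker := AddSubgroup.ext hmem
      have hπ : Function.Surjective π := fun z =>
        ⟨e.symm (0, 0, z), by
          change (e (e.symm (0, 0, z))).2.2 = z
          rw [e.apply_symm_apply]⟩
      have : AddGroup.FG ((Fin r → ℤ) × T) :=
        Module.Finite.iff_addGroup_fg.1 (inferInstance : Module.Finite ℤ ((Fin r → ℤ) × T))
      let ψ := (QuotientAddGroup.quotientAddEquivOfEq hker).trans
        (QuotientAddGroup.quotientKerEquivOfSurjective π hπ)
      exact AddGroup.fg_of_surjective (f := ψ.symm.toAddMonoidHom) ψ.symm.surjective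
    · rw [← card_torsion_QmodZ_pow s hn]
      refine Nat.card_congr (Equiv.ofBijective
        (fun x => ⟨(e x.1.1).2.1, ?_⟩) ⟨?_, ?_⟩)
      · have h : n • (x.1 : G) = 0 := congrArg Subtype.val x.2
        have h' := congrArg e h
        rw [map_nsmul, map_zero] at h'
        exact congrArg (fun z => z.2.1) h'
      · rintro ⟨x, hx⟩ ⟨y, hy⟩ hxy
        have hV0 : ∀ z : divisibleSubgroup G, n • z = 0 → (e z).1 = 0 := by
          intro z hz
          have h := congrArg (fun t : divisibleSubgroup G => (e (t : G)).1) hz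
          refine (hV 0 n hn).unique ?_ (smul_zero n)
          simpa using h
        refine Subtype.ext (Subtype.ext (e.injective (Prod.ext ?_ (Prod.ext ?_ ?_))))
        · exact (hV0 x hx).trans (hV0 y hy).symm
        · exact congrArg Subtype.val hxy
        · exact ((hmem x).1 x.2).trans ((hmem y).1 y.2).symm
      · rintro ⟨y, hy⟩
        refine ⟨⟨⟨e.symm (0, y, 0), (hmem _).2 ?_⟩, Subtype.ext (e.injective ?_)⟩,
          Subtype.ext ?_⟩
        · rw [e.apply_symm_apply]
        · change e (n • e.symm (0, y, 0)) = e 0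
          rw [map_nsmul, e.apply_symm_apply, map_zero]
          exact Prod.ext (smul_zero n) (Prod.ext hy (smul_zero n))
        · change (e (e.symm (0, y, 0))).2.1 = y
          rw [e.apply_symm_apply]
  · rintro ⟨_, s, hcard⟩
    obtain ⟨V, _, hV, ⟨α⟩⟩ :=
      exists_addEquiv_uniquelyDivisible_prod divisibleSubgroup_exists_nsmul_eq hcard
    obtain ⟨r, T, _, hT, ⟨β⟩⟩ := exists_addEquiv_free_prod_finite (G ⧸ divisibleSubgroup G)
    have hsplit := nonempty_addEquiv_ker_prod (QuotientAddGroup.mk' (divisibleSubgroup G))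
      (QuotientAddGroup.mk'_surjective _)
    rw [QuotientAddGroup.ker_mk'] at hsplit
    obtain ⟨γ⟩ := hsplit divisibleSubgroup_exists_nsmul_eq
    exact ⟨s, r, V, T, inferInstance, inferInstance, hV, hT,
      ⟨γ.trans ((AddEquiv.prodCongr α β).trans AddEquiv.prodAssoc)⟩⟩
end
end

section
/- Let A and B be mild abelian groups with s(B) = 0 (i.e., B has no nonzero divisible torsion element), and let f: A → B be a group homomorphism. Then the kernel of f is a mild abelian group. -/
noncomputable section

universe u v

/-- Every element of `(ℚ/ℤ)^s` is torsion. -/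
lemma torsionSubgroup_pi_QmodZ (s : ℕ) : torsionSubgroup (Fin s → QmodZ) = ⊤ := by
  have torsion (x : QmodZ) : ∃ n : ℕ, 0 < n ∧ n • x = 0 := by
    induction x using QuotientAddGroup.induction_on with
    | H q =>
      refine ⟨q.den, q.den_pos, ?_⟩
      have h : ((q.den • q : ℚ) : QmodZ) = 0 := by
        rw [AddCircle.coe_eq_zero_iff]
        exact ⟨q.num, by simp [Rat.den_mul_eq_num]⟩
      rwa [AddCircle.coe_nsmul] at h
  refine eq_top_iff.2 fun d _ ↦ ?_
  choose n hn hnd using fun i ↦ torsion (d i)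
  refine ⟨∏ i, n i, Finset.prod_pos fun i _ ↦ hn i, funext fun i ↦ ?_⟩
  obtain ⟨k, hk⟩ := Finset.dvd_prod_of_mem n (Finset.mem_univ i)
  rw [Pi.smul_apply, hk, mul_comm, mul_smul, hnd i, smul_zero, Pi.zero_apply]

/-- The group `(ℚ/ℤ)^s` is divisible. -/
lemma divisibleSubgroup_pi_QmodZ (s : ℕ) : divisibleSubgroup (Fin s → QmodZ) = ⊤ :=
  eq_top_iff.2 fun d _ n hn ↦ ⟨fun i ↦ DivisibleBy.div (d i) (n : ℤ), funext fun i ↦ by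
    simpa using DivisibleBy.div_cancel (d i) (Int.natCast_ne_zero.2 hn.ne')⟩

lemma map_mem_divisibleSubgroup {G H : Type*} [AddCommGroup G] [AddCommGroup H] (f : G →+ H)
    {g : G} (hg : g ∈ divisibleSubgroup G) : f g ∈ divisibleSubgroup H := fun n hn ↦ by
  obtain ⟨x, rfl⟩ := hg n hn
  exact ⟨f x, (map_nsmul f n x).symm⟩

lemma map_mem_torsionSubgroup {G H : Type*} [AddCommGroup G] [AddCommGroup H] (f : G →+ H)
    {g : G} (hg : g ∈ torsionSubgroup G) : f g ∈ torsionSubgroup H := by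
  obtain ⟨n, hn, h⟩ := hg
  exact ⟨n, hn, by rw [← map_nsmul, h, map_zero]⟩

lemma eq_zero_of_tdSubgroup_eq_bot {G : Type*} [AddCommGroup G] (hG : tdSubgroup G = ⊥) {g : G}
    (ht : g ∈ torsionSubgroup G) (hd : g ∈ divisibleSubgroup G) : g = 0 := by
  have h : g ∈ tdSubgroup G := ⟨ht, hd⟩
  simpa [hG] using h

/-- The kernel of a homomorphism from a uniquely divisible group to a group without nonzero
divisible torsion is uniquely divisible. -/
lemma IsUniquelyDivisible.ker {V H : Type*} [AddCommGroup V] [AddCommGroup H]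
    (hV : IsUniquelyDivisible V) (hH : tdSubgroup H = ⊥) (f : V →+ H) :
    IsUniquelyDivisible f.ker := by
  rintro ⟨v, hv⟩ n hn
  obtain ⟨w, hw, huniq⟩ := hV v n hn
  have hfw : f w = 0 :=
    eq_zero_of_tdSubgroup_eq_bot hH ⟨n, hn, by rw [← map_nsmul, hw, hv]⟩
      (map_mem_divisibleSubgroup f fun m hm ↦ (hV w m hm).exists)
  exact ⟨⟨w, hfw⟩, Subtype.ext hw, fun y hy ↦ Subtype.ext (huniq y (congrArg Subtype.val hy))⟩

/-- An extension of a subgroup of a group by a divisible group splits. -/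
lemma nonempty_addEquiv_prod_range {K D F : Type*} [AddCommGroup K] [AddCommGroup D]
    [AddCommGroup F] (hD : divisibleSubgroup D = ⊤) (i : D →+ K) (hi : Function.Injective i)
    (p : K →+ F) (hip : i.range = p.ker) : Nonempty (K ≃+ D × p.range) := by
  have hsurj {n : ℤ} (hn : n ≠ 0) : Function.Surjective fun d : D ↦ n • d := fun d ↦ by
    obtain ⟨x, hx⟩ : ∃ x, n.natAbs • x = d :=
      (hD ▸ AddSubgroup.mem_top d : d ∈ divisibleSubgroup D) _ (Int.natAbs_pos.2 hn)
    rcases Int.natAbs_eq n with h | h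
    · exact ⟨x, by dsimp only; rw [h, natCast_zsmul, hx]⟩
    · exact ⟨-x, by dsimp only; rw [h, neg_smul, smul_neg, neg_neg, natCast_zsmul, hx]⟩
  let _ : DivisibleBy D ℤ := divisibleByOfSMulRightSurj D ℤ hsurj
  obtain ⟨ρ, hρ⟩ := (Module.Baer.of_divisible D).extension_property_addMonoidHom i hi (.id D)
  replace hρ (d : D) : ρ (i d) = d := DFunLike.congr_fun hρ d
  have hpi (d : D) : p (i d) = 0 := (hip ▸ ⟨d, rfl⟩ : i d ∈ p.ker)
  refine ⟨AddEquiv.ofBijective (ρ.prod p.rangeRestrict) ⟨?_, ?_⟩⟩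
  · refine (injective_iff_map_eq_zero _).2 fun k hk ↦ ?_
    obtain ⟨hρk, hpk⟩ := Prod.ext_iff.1 hk
    obtain ⟨d, rfl⟩ : k ∈ i.range := hip ▸ congrArg Subtype.val hpk
    have hd : d = 0 := (hρ d).symm.trans hρk
    rw [hd, map_zero]
  · rintro ⟨d, _, k, rfl⟩
    refine ⟨i d + k - i (ρ k), Prod.ext ?_ (Subtype.ext ?_)⟩
    · simp [hρ]
    · simp [hpi]

/-- The product of a uniquely divisible group, a power of `ℚ/ℤ` and a finitely generated group
is mild. -/
lemma IsMild.of_addEquiv_prod {G W F : Type u} [AddCommGroup G] [AddCommGroup W] [AddCommGroup F]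
    [AddGroup.FG F] (hW : IsUniquelyDivisible W) {s : ℕ}
    (e : G ≃+ (W × (Fin s → QmodZ)) × F) : IsMild G := by
  obtain ⟨r, ι, _, p, hp, k, ⟨e'⟩⟩ := AddCommGroup.equiv_free_prod_directSum_zmod F
  have (i : ι) : NeZero (p i ^ k i) := ⟨pow_ne_zero _ (hp i).ne_zero⟩
  refine ⟨s, r, W, ULift.{u} ((i : ι) → ZMod (p i ^ k i)), inferInstance, inferInstance, hW,
    inferInstance, ⟨e.trans (AddEquiv.prodAssoc.trans ?_)⟩⟩
  refine (AddEquiv.refl W).prodCongr ((AddEquiv.refl _).prodCongr (e'.trans ?_))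
  exact (Finsupp.linearEquivFunOnFinite ℤ ℤ (Fin r)).toAddEquiv.prodCongr
    ((DirectSum.addEquivProd _).trans AddEquiv.ulift.symm)

/-- If `A` and `B` are mild abelian groups, `B` has no nonzero divisible
torsion element (i.e. `s(B) = 0`), and `f : A → B` is a homomorphism, then `ker f` is mild. -/
theorem kernel_isMild_of_target_no_divisible_torsion
    {A B : Type u} [AddCommGroup A] [AddCommGroup B]
    (hA : IsMild A) (hB : IsMild B) (hB0 : tdSubgroup B = ⊥)
    (f : A →+ B) :
    IsMild f.ker := by
  obtain ⟨s, r, V, T, _, _, hV, hT, ⟨e⟩⟩ := hA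
  let g : V × (Fin s → QmodZ) × (Fin r → ℤ) × T →+ B := f.comp e.symm.toAddMonoidHom
  have hg (d : Fin s → QmodZ) : g (0, d, 0) = 0 := by
    let j : (Fin s → QmodZ) →+ B := g.comp ((AddMonoidHom.inr _ _).comp (AddMonoidHom.inl _ _))
    exact eq_zero_of_tdSubgroup_eq_bot hB0
      (map_mem_torsionSubgroup j (torsionSubgroup_pi_QmodZ s ▸ AddSubgroup.mem_top d))
      (map_mem_divisibleSubgroup j (divisibleSubgroup_pi_QmodZ s ▸ AddSubgroup.mem_top d))
  let W := (g.comp (AddMonoidHom.inl _ _)).ker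
  have hW : IsUniquelyDivisible W := hV.ker hB0 _
  let i : W × (Fin s → QmodZ) →+ f.ker :=
    (e.symm.toAddMonoidHom.comp
      (W.subtype.prodMap (AddMonoidHom.inl (Fin s → QmodZ) ((Fin r → ℤ) × T)))).codRestrict _
      fun x ↦ by
        have h : g (x.1, x.2, 0) = g (x.1, 0) + g (0, x.2, 0) := by rw [← map_add]; simp
        exact h.trans (by rw [hg, add_zero]; exact x.1.2)
  let p : f.ker →+ (Fin r → ℤ) × T :=
    ((AddMonoidHom.snd _ _).comp (AddMonoidHom.snd _ _)).comp
      (e.toAddMonoidHom.comp f.ker.subtype)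
  have hei (x : W × (Fin s → QmodZ)) : e (i x) = (x.1.1, x.2, 0) := e.apply_symm_apply _
  have hi : Function.Injective i := fun x y hxy ↦ by
    have h := (hei x).symm.trans ((congrArg (fun k : f.ker ↦ e k) hxy).trans (hei y))
    simp only [Prod.mk.injEq, and_true] at h
    exact Prod.ext (Subtype.ext h.1) h.2
  have hip : i.range = p.ker := by
    ext k
    constructor
    · rintro ⟨x, rfl⟩
      exact congrArg (fun y ↦ y.2.2) (hei x)
    · intro hk
      have hek : e k = ((e k).1, (e k).2.1, 0) := Prod.ext rfl (Prod.ext rfl hk)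
      have hgk : g (e k) = 0 := (congrArg f (e.symm_apply_apply _)).trans k.2
      have hw : (e k).1 ∈ W := by
        have h : g ((e k).1, 0) + g (0, (e k).2.1, 0) = 0 := by
          rw [← map_add, ← hgk, hek]; simp
        rwa [hg, add_zero] at h
      exact ⟨(⟨_, hw⟩, (e k).2.1), Subtype.ext (e.injective ((hei _).trans hek.symm))⟩
  have hdiv : divisibleSubgroup (W × (Fin s → QmodZ)) = ⊤ := by
    refine eq_top_iff.2 fun x _ n hn ↦ ?_
    obtain ⟨w, hw⟩ := (hW x.1 n hn).exists
    obtain ⟨d, hd⟩ := (divisibleSubgroup_pi_QmodZ s ▸ AddSubgroup.mem_top x.2 :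
      x.2 ∈ divisibleSubgroup (Fin s → QmodZ)) n hn
    exact ⟨(w, d), Prod.ext hw hd⟩
  obtain ⟨e'⟩ := nonempty_addEquiv_prod_range hdiv i hi p hip
  have : Module.Finite ℤ T := .of_finite
  have : AddGroup.FG p.range :=
    Module.Finite.iff_addGroup_fg.1
      (inferInstanceAs (Module.Finite ℤ (AddSubgroup.toIntSubmodule p.range)))
  exact .of_addEquiv_prod hW e'
end
end

section
/- Let n be a positive integer and let φ: M → N be a homomorphism of ℤ/nℤ-modules. If the dual homomorphism φ^∨: N^∨ → M^∨ is an isomorphism, then φ is an isomorphism. -/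
universe u

/-- A homomorphism from a `ℤ/nℤ`-module to `ℚ/ℤ` takes values in the `n`-torsion, which is a
copy of `ℤ/nℤ`; hence linear functionals separate points. -/
theorem ZMod.exists_linearMap_apply_ne_zero {n : ℕ} (hn : 0 < n) {M : Type*} [AddCommGroup M]
    [Module (ZMod n) M] {x : M} (hx : x ≠ 0) : ∃ f : M →ₗ[ZMod n] ZMod n, f x ≠ 0 := by
  have : Fact ((0 : ℚ) < 1) := ⟨one_pos⟩
  obtain ⟨c, hc⟩ := CharacterModule.exists_character_apply_ne_zero_of_ne_zero hx
  let u : AddCircle (1 : ℚ) := ((1 / n : ℚ) : AddCircle (1 : ℚ))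
  have hu : addOrderOf u = n := AddCircle.addOrderOf_period_div hn
  let z : ℤ →+ AddCircle (1 : ℚ) := zmultiplesHom _ u
  have hz : z n = 0 := by
    simp only [z, zmultiplesHom_apply, natCast_zsmul]
    exact addOrderOf_dvd_iff_nsmul_eq_zero.mp hu.dvd
  let ψ : ZMod n →+ AddCircle (1 : ℚ) := ZMod.lift n ⟨z, hz⟩
  have hψ : Function.Injective ψ := by
    refine (ZMod.lift_injective _).2 fun m hm ↦ ?_
    rw [ZMod.intCast_zmod_eq_zero_iff_dvd, ← hu]
    exact addOrderOf_dvd_iff_zsmul_eq_zero.mpr hm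
  have hrange (y : M) : c y ∈ ψ.range := by
    have hy : n • c y = 0 := by
      rw [← map_nsmul, ← Nat.cast_smul_eq_nsmul (ZMod n), ZMod.natCast_self, zero_smul, map_zero]
    obtain ⟨m, -, hm⟩ := (AddCircle.nsmul_eq_zero_iff hn).mp hy
    refine ⟨((m : ℤ) : ZMod n), ?_⟩
    rw [← hm]
    simp only [ψ, ZMod.lift_coe, z, zmultiplesHom_apply, natCast_zsmul, u, ← AddCircle.coe_nsmul]
    congr 1
    simp [div_eq_mul_inv]
  let f : M →+ ZMod n := (AddMonoidHom.ofInjective hψ).symm.toAddMonoidHom.comp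
    (AddMonoidHom.codRestrict (c : M →+ AddCircle (1 : ℚ)) ψ.range hrange)
  refine ⟨f.toZModLinearMap n, fun h ↦ hc ?_⟩
  have h' : (AddMonoidHom.ofInjective hψ).symm ⟨c x, hrange x⟩ = 0 := h
  rw [map_eq_zero_iff _ (AddEquiv.injective _)] at h'
  exact congrArg Subtype.val h'

/-- Let `n` be a positive integer and `φ : M → N` a homomorphism of
`ℤ/nℤ`-modules.  If the dual homomorphism `φ^∨ : N^∨ → M^∨` (given by precomposition with
`φ`, where `M^∨ = Hom_{ℤ/nℤ}(M, ℤ/nℤ)`) is an isomorphism, then `φ` is an isomorphism. -/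
theorem bijective_of_dual_bijective
    (n : ℕ) (hn : 0 < n)
    {M N : Type u} [AddCommGroup M] [AddCommGroup N]
    [Module (ZMod n) M] [Module (ZMod n) N]
    (φ : M →ₗ[ZMod n] N)
    (hdual : Function.Bijective
      (fun g : N →ₗ[ZMod n] ZMod n => g.comp φ)) :
    Function.Bijective φ := by
  constructor
  · refine (injective_iff_map_eq_zero φ).mpr fun x hx ↦ ?_
    by_contra hne
    obtain ⟨f, hf⟩ := ZMod.exists_linearMap_apply_ne_zero hn hne
    obtain ⟨g, rfl⟩ := hdual.surjective f
    exact hf (by simp [hx])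
  · intro y
    by_contra hy
    have hne : φ.range.mkQ y ≠ 0 := by simpa using hy
    obtain ⟨f, hf⟩ := ZMod.exists_linearMap_apply_ne_zero hn hne
    have h : f.comp φ.range.mkQ = 0 := hdual.injective <| by
      simp [LinearMap.comp_assoc, LinearMap.range_mkQ_comp]
    exact hf (LinearMap.congr_fun h y)
end

section
/- Let Δ: ℤ → ∏_p ℤ_p be the diagonal embedding of ℤ into the product of the rings of p-adic integers over all primes p. Then the quotient group (∏_p ℤ_p)/Δ(ℤ) is uniquely divisible, i.e., for every element x of the quotient and every positive integer n there is a unique element y of the quotient with n·y = x (equivalently, the quotient is divisible and torsion-free). -/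
noncomputable section

instance (p : Nat.Primes) : Fact (p : ℕ).Prime := ⟨p.2⟩

/-- The diagonal embedding `ℤ → ∏_p ℤ_p`. -/
def diagZ : ℤ →+ (∀ p : Nat.Primes, ℤ_[p]) where
  toFun m := fun p => (m : ℤ_[p])
  map_zero' := by funext p; simp
  map_add' a b := by funext p; simp [Pi.add_apply]

theorem natCast_prime_dvd_padicInt_of_ne {p q : ℕ} [Fact p.Prime] (hq : q.Prime) (hpq : p ≠ q)
    (x : ℤ_[p]) : (q : ℤ_[p]) ∣ x := by
  refine IsUnit.dvd (PadicInt.isUnit_iff.mpr ?_)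
  refine le_antisymm (PadicInt.norm_le_one _) (not_lt.mp fun h => hpq ?_)
  have h' : ‖((q : ℤ) : ℤ_[p])‖ < 1 := by simpa using h
  rw [PadicInt.norm_int_lt_one_iff_dvd, Int.natCast_dvd_natCast] at h'
  exact (Nat.prime_dvd_prime_iff_eq Fact.out hq).mp h'

theorem exists_int_prime_dvd_sub (q : Nat.Primes) (x : ∀ p : Nat.Primes, ℤ_[p]) :
    ∃ m : ℤ, ∀ p : Nat.Primes, ((q : ℕ) : ℤ_[p]) ∣ x p - m := by
  refine ⟨(x q).zmodRepr, fun p => ?_⟩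
  by_cases h : p = q
  · subst h
    have := PadicInt.sub_zmodRepr_mem (x p)
    rw [PadicInt.maximalIdeal_eq_span_p, Ideal.mem_span_singleton] at this
    simpa using this
  · exact natCast_prime_dvd_padicInt_of_ne q.2 (Subtype.coe_injective.ne h) _

theorem dvd_of_nsmul_eq_diagZ {q : Nat.Primes} {x : ∀ p : Nat.Primes, ℤ_[p]} {m : ℤ}
    (h : (q : ℕ) • x = diagZ m) : ((q : ℕ) : ℤ) ∣ m := by
  have hx : ((q : ℕ) : ℤ_[q]) * x q = m := by
    simpa [diagZ] using congrFun h q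
  rw [← PadicInt.norm_int_lt_one_iff_dvd, ← hx, norm_mul]
  exact mul_lt_one_of_nonneg_of_lt_one_left (norm_nonneg _)
    (PadicInt.mem_nonunits.mp PadicInt.p_nonunit) (PadicInt.norm_le_one _)

theorem surjective_prime_nsmul_quotient_diagZ (q : Nat.Primes) :
    Function.Surjective
      fun w : (∀ p : Nat.Primes, ℤ_[p]) ⧸ diagZ.range => (q : ℕ) • w := by
  intro v
  obtain ⟨x, rfl⟩ := QuotientAddGroup.mk_surjective v
  obtain ⟨m, hm⟩ := exists_int_prime_dvd_sub q x
  choose y hy using hm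
  refine ⟨QuotientAddGroup.mk y, ?_⟩
  change (((q : ℕ) • y : ∀ p : Nat.Primes, ℤ_[p]) : _ ⧸ diagZ.range) = x
  refine QuotientAddGroup.eq.mpr ⟨m, ?_⟩
  funext p
  simp [diagZ, ← hy p]

theorem injective_prime_nsmul_quotient_diagZ (q : Nat.Primes) :
    Function.Injective
      fun w : (∀ p : Nat.Primes, ℤ_[p]) ⧸ diagZ.range => (q : ℕ) • w := by
  refine (injective_iff_map_eq_zero
    (nsmulAddMonoidHom (α := (∀ p : Nat.Primes, ℤ_[p]) ⧸ diagZ.range) (q : ℕ))).mpr fun v hv => ?_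
  obtain ⟨x, rfl⟩ := QuotientAddGroup.mk_surjective v
  obtain ⟨m, hm⟩ := (QuotientAddGroup.eq_zero_iff ((q : ℕ) • x)).mp hv
  obtain ⟨k, rfl⟩ := dvd_of_nsmul_eq_diagZ hm.symm
  refine (QuotientAddGroup.eq_zero_iff x).mpr ⟨k, ?_⟩
  funext p
  have h : ((q : ℕ) : ℤ_[p]) * k = (q : ℕ) * x p := by simpa [diagZ] using congrFun hm p
  exact mul_left_cancel₀ (Nat.cast_ne_zero.mpr q.2.ne_zero) h

theorem IsUniquelyDivisible.of_bijective_prime_nsmul {V : Type*} [AddCommGroup V]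
    (h : ∀ q : ℕ, q.Prime → Function.Bijective fun w : V => q • w) :
    IsUniquelyDivisible V := by
  suffices H : ∀ n : ℕ, n ≠ 0 → Function.Bijective fun w : V => n • w from
    fun v n hn => (H n hn.ne').existsUnique v
  intro n
  induction n using induction_on_primes with
  | zero => exact fun hn => absurd rfl hn
  | one => simpa using! Function.bijective_id
  | prime_mul q n hq ih =>
    intro hn
    simpa only [Function.comp_def, ← mul_smul] using
      (h q hq).comp (ih (right_ne_zero_of_mul hn))

/-- The quotient `(∏_p ℤ_p)/ℤ` of the product of all rings of `p`-adic
integers by the diagonally embedded `ℤ` is uniquely divisible. -/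
theorem quotient_prod_padicInt_by_diagonal_uniquelyDivisible :
    IsUniquelyDivisible ((∀ p : Nat.Primes, ℤ_[p]) ⧸ diagZ.range) := by
  exact .of_bijective_prime_nsmul fun q hq =>
    ⟨injective_prime_nsmul_quotient_diagZ ⟨q, hq⟩, surjective_prime_nsmul_quotient_diagZ ⟨q, hq⟩⟩
end
end
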